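/- Let (K, d) be a compact metric space, X ⊆ K a dense subset, E a finite-dimensional normed space over ℝ, and α > β > 0. Let B be a bounded subset of the space BL_α(X, E) of bounded α-Hölder maps X → E, i.e. sup_{f∈B} ‖f‖_∞ < ∞ and sup_{f∈B} Lip_α(f) < ∞. Then the topologies induced on B by the supremum norm ‖·‖_∞ and by the Hölder norm ‖·‖_β = max{‖·‖_∞, Lip_β(·)} coincide. -/

import Mathlib

open NNReal

/-- For exponents `β < α` and `ε > 0`, a quantity bounded by both `A * t ^ α` and a sufficiently
small constant `δ`, independent of `t`, is bounded by `ε * t ^ β`. -/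
theorem Real.exists_pos_forall_le_mul_rpow {α β A ε : ℝ} (hβ : 0 ≤ β) (hβα : β < α) (hA : 0 ≤ A)
    (hε : 0 < ε) :
    ∃ δ : ℝ, 0 < δ ∧ ∀ t s : ℝ, 0 < t → s ≤ A * t ^ α → s ≤ δ → s ≤ ε * t ^ β := by
  have hγ : 0 < α - β := sub_pos.2 hβα
  have hq : 0 < ε / (A + 1) := by positivity
  set η : ℝ := (ε / (A + 1)) ^ (α - β)⁻¹ with hη
  have hη0 : 0 < η := Real.rpow_pos_of_pos hq _
  refine ⟨ε * η ^ β, by positivity, fun t s ht hsα hsδ => ?_⟩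
  rcases le_total t η with htη | hηt
  · have hle : A * t ^ (α - β) ≤ ε := calc
      A * t ^ (α - β) ≤ A * η ^ (α - β) := by gcongr
      _ = A * (ε / (A + 1)) := by rw [hη, Real.rpow_inv_rpow hq.le hγ.ne']
      _ ≤ (A + 1) * (ε / (A + 1)) := by gcongr; linarith
      _ = ε := by field_simp
    calc s ≤ A * t ^ α := hsα
      _ = A * t ^ (α - β) * t ^ β := by rw [mul_assoc, ← Real.rpow_add ht, sub_add_cancel]
      _ ≤ ε * t ^ β := by gcongr
  · exact hsδ.trans (by gcongr)

/-- On a set `B` of maps on a dense subset `X` of a compact metric space `K`,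
bounded in sup-norm and with uniformly bounded `α`-Hölder constants, the
topology of the `β`-Hölder norm (`β < α`) coincides with the topology of the
supremum norm: sup-norm closeness implies `‖·‖_β`-closeness within `B` (the
converse implication being trivial since `‖·‖_∞ ≤ ‖·‖_β`). -/
theorem holder_sup_topologies_coincide
    {K : Type*} [MetricSpace K] [CompactSpace K] (X : Set K) (hX : Dense X)
    {E : Type*} [NormedAddCommGroup E] [NormedSpace ℝ E] [FiniteDimensional ℝ E]
    (α β : ℝ≥0) (hβ : 0 < β) (hβα : β < α) (M : ℝ) (C : ℝ≥0)
    (B : Set (X → E))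
    (hB : ∀ f ∈ B, (∀ x, ‖f x‖ ≤ M) ∧ HolderWith C α f) :
    ∀ f ∈ B, ∀ ε : ℝ, 0 < ε → ∃ δ : ℝ, 0 < δ ∧ ∀ g ∈ B,
      (∀ x, ‖f x - g x‖ ≤ δ) →
        (∀ x, ‖f x - g x‖ ≤ ε) ∧
        ∀ x y : X, x ≠ y →
          ‖(f x - g x) - (f y - g y)‖ ≤ ε * dist x y ^ (β : ℝ) := by
  intro f hf ε hε
  obtain ⟨δ, hδ, hinterp⟩ := Real.exists_pos_forall_le_mul_rpow (A := 2 * C) β.coe_nonneg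
    (NNReal.coe_lt_coe.2 hβα) (by positivity) hε
  refine ⟨min ε (δ / 2), by positivity, fun g hg hfg =>
    ⟨fun x => (hfg x).trans (min_le_left _ _), fun x y hxy => ?_⟩⟩
  refine hinterp _ _ (dist_pos.2 hxy) ?_ ?_
  · have hfd := (hB f hf).2.dist_le x y
    have hgd := (hB g hg).2.dist_le x y
    rw [dist_eq_norm] at hfd hgd
    calc ‖(f x - g x) - (f y - g y)‖ = ‖(f x - f y) - (g x - g y)‖ := by rw [sub_sub_sub_comm]
      _ ≤ ‖f x - f y‖ + ‖g x - g y‖ := norm_sub_le _ _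
      _ ≤ 2 * C * dist x y ^ (α : ℝ) := by linarith
  · have hx := (hfg x).trans (min_le_right _ _)
    have hy := (hfg y).trans (min_le_right _ _)
    linarith [norm_sub_le (f x - g x) (f y - g y)]
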